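/- Under the stated assumptions, if λ(Λ) ∈ ℝ satisfies |λ(Λ)| ≤ |Λ|^{(1−η/d)/2} for each L, then ∫_{[0,∞)} e^{λ(Λ)(s − ρ_c^{(Λ)})} dμ_Λ(s) → 1 as L → ∞, where ρ_c^{(Λ)} = ∑_{j≥1} e^{−α_j} |Λ|^{−1} ∑_{k∈Λ*, k≠0} e^{−j ε(k)}. -/

import Mathlib

open MeasureTheory Filter Topology ENNReal
open scoped Classical

noncomputable section

/-- `r_j(π)`: the number of cycles of length `j` in `π ∈ S_n`
(fixed points count as cycles of length 1). -/
def cycCount {n : ℕ} (π : Equiv.Perm (Fin n)) (j : ℕ) : ℕ :=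
  if j = 1 then n - π.cycleType.sum else Multiset.count j π.cycleType

/-- The cycle weight `exp(-∑_{j≥1} α_j r_j(π))` of a permutation `π ∈ S_n`. -/
def permWeight (α : ℕ → ℝ) {n : ℕ} (π : Equiv.Perm (Fin n)) : ℝ :=
  Real.exp (-∑ j ∈ Finset.Icc 1 n, α j * (cycCount π j : ℝ))

/-- `h_n = (n!)⁻¹ ∑_{π ∈ S_n} e^{-∑_{j≥1} α_j r_j(π)}`, with `h_0 = 1`. -/
def hcoef (α : ℕ → ℝ) (n : ℕ) : ℝ :=
  (n.factorial : ℝ)⁻¹ * ∑ π : Equiv.Perm (Fin n), permWeight α π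

/-- Euclidean space `ℝ^d`. -/
abbrev Eu (d : ℕ) := EuclideanSpace ℝ (Fin d)

/-- The dual lattice point `z/L ∈ Λ* = L⁻¹ℤ^d`, for `z ∈ ℤ^d`. -/
def dualPt (d : ℕ) (L : ℝ) (z : Fin d → ℤ) : Eu d :=
  (WithLp.equiv 2 (Fin d → ℝ)).symm (fun i => (z i) / L)

/-- The critical density `ρ_c = ∑_{j≥1} e^{-α_j} ∫_{ℝ^d} e^{-jε(k)} dk`. -/
def rhoC (d : ℕ) (ε : Eu d → ℝ) (α : ℕ → ℝ) : ℝ :=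
  ∑' j : ℕ, Real.exp (-α (j+1)) * ∫ k : Eu d, Real.exp (-(((j:ℝ)+1) * ε k))

/-- The finite-volume critical density
`ρ_c^{(Λ)} = ∑_{j≥1} e^{-α_j} |Λ|⁻¹ ∑_{k∈Λ*, k≠0} e^{-jε(k)}`. -/
def rhoCL (d : ℕ) (ε : Eu d → ℝ) (α : ℕ → ℝ) (L : ℝ) : ℝ :=
  ∑' j : ℕ, Real.exp (-α (j+1)) *
    ((L ^ d)⁻¹ * ∑' z : Fin d → ℤ,
      if z = 0 then 0 else Real.exp (-(((j:ℝ)+1) * ε (dualPt d L z))))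

/-- `Ž(N)`: the partition function over occupation numbers `(n_k)_{k∈Λ*}` with
`∑_k n_k = N` and `n_0 = 0`, namely `∑_n ∏_{k∈Λ*} e^{-ε(k)n_k} h_{n_k}`
(the product reduces to the support of `n` since `h_0 = 1`). -/
def Zcheck (d : ℕ) (ε : Eu d → ℝ) (α : ℕ → ℝ) (L : ℝ) (N : ℕ) : ℝ≥0∞ :=
  ∑' n : (Fin d → ℤ) →₀ ℕ,
    if (n.sum fun _ m => m) = N ∧ n 0 = 0 then
      ∏ k ∈ n.support,
        ENNReal.ofReal (Real.exp (-(ε (dualPt d L k) * n k)) * hcoef α (n k))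
    else 0

/-- Expansion of a finite product of series into a sum over multi-indices. -/
theorem tsum_finsupp_support_subset {ι : Type*} (f : ι → ℕ → ℝ≥0∞) (s : Finset ι) :
    ∑' n : ι →₀ ℕ, (if n.support ⊆ s then ∏ k ∈ s, f k (n k) else 0) =
      ∏ k ∈ s, ∑' m, f k m := by
  induction s using Finset.induction_on with
  | empty =>
    rw [tsum_eq_single 0]
    · simp
    · intro n hn
      simpa using hn
  | insert a s has ih =>
    rw [Finset.prod_insert has, ← ih, ← ENNReal.tsum_mul_right]
    simp_rw [← ENNReal.tsum_mul_left]
    rw [← ENNReal.tsum_prod (f := fun m (n : ι →₀ ℕ) =>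
      f a m * (if n.support ⊆ s then ∏ k ∈ s, f k (n k) else 0))]
    have hval : ∀ (m : ℕ) (n : ι →₀ ℕ), n.support ⊆ s →
        f a m * ∏ k ∈ s, f k (n k) = ∏ k ∈ insert a s, f k (n.update a m k) := by
      intro m n _
      rw [Finset.prod_insert has]
      congr 1
      · simp
      · refine Finset.prod_congr rfl fun k hk => ?_
        rw [Finsupp.update_apply, if_neg (by rintro rfl; exact has hk)]
    have hsupp : ∀ p : Function.support (fun p : ℕ × (ι →₀ ℕ) =>
        f a p.1 * (if p.2.support ⊆ s then ∏ k ∈ s, f k (p.2 k) else 0)),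
        p.1.2.support ⊆ s := by
      intro p
      by_contra h
      exact p.2 (by simp [h])
    have hzero : ∀ n : ι →₀ ℕ, n.support ⊆ s → n a = 0 := fun n hn =>
      Finsupp.notMem_support_iff.mp fun h => has (hn h)
    refine tsum_eq_tsum_of_ne_zero_bij (fun p => p.1.2.update a p.1.1) ?_ ?_ ?_
    · intro p q hpq
      have hp := hzero _ (hsupp p)
      have hq := hzero _ (hsupp q)
      have h : ∀ k, p.1.2.update a p.1.1 k = q.1.2.update a q.1.1 k := fun k =>
        DFunLike.congr_fun hpq k
      refine Subtype.ext (Prod.ext ?_ (Finsupp.ext fun k => ?_))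
      · simpa using h a
      · by_cases hk : k = a
        · rw [hk, hp, hq]
        · simpa [Finsupp.update_apply, hk] using h k
    · intro n hn
      have hns : n.support ⊆ insert a s := by
        by_contra h
        exact hn (by simp [h])
      have hes : (n.erase a).support ⊆ s := by
        rw [Finsupp.support_erase]
        exact Finset.subset_insert_iff.mp hns
      have hup : (n.erase a).update a (n a) = n := by simp
      refine ⟨⟨(n a, n.erase a), ?_⟩, hup⟩
      rw [Function.mem_support] at hn ⊢
      simp only [hes, if_true]
      rw [hval _ _ hes, hup]
      simpa [hns] using hn
    · intro p
      have hp := hsupp p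
      have : (p.1.2.update a p.1.1).support ⊆ insert a s := by
        intro k hk
        by_cases hka : k = a
        · simp [hka]
        · refine Finset.mem_insert_of_mem (hp ?_)
          simpa [Finsupp.update_apply, hka] using hk
      simp only [this, hp, if_true]
      exact (hval _ _ hp).symm

/-- Expansion of an infinite product of series with constant term one, in the case where the
factors are exponentials with summable exponents. -/
theorem tsum_finsupp_prod_eq_exp {ι : Type*} (f : ι → ℕ → ℝ≥0∞) (hf0 : ∀ k, f k 0 = 1)
    (g : ι → ℝ) (hg0 : ∀ k, 0 ≤ g k) (hg : Summable g)
    (hfg : ∀ k, ∑' m, f k m = ENNReal.ofReal (Real.exp (g k))) :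
    ∑' n : ι →₀ ℕ, ∏ k ∈ n.support, f k (n k) = ENNReal.ofReal (Real.exp (∑' k, g k)) := by
  have hprod : ∀ (s : Finset ι) (n : ι →₀ ℕ), n.support ⊆ s →
      ∏ k ∈ s, f k (n k) = ∏ k ∈ n.support, f k (n k) := by
    intro s n hn
    refine (Finset.prod_subset hn fun k _ hk => ?_).symm
    rw [Finsupp.notMem_support_iff.mp hk, hf0]
  have hpart : ∀ s : Finset ι,
      ∑' n : ι →₀ ℕ, (if n.support ⊆ s then ∏ k ∈ s, f k (n k) else 0) =
        ENNReal.ofReal (Real.exp (∑ k ∈ s, g k)) := by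
    intro s
    rw [tsum_finsupp_support_subset, Real.exp_sum,
      ENNReal.ofReal_prod_of_nonneg fun k _ => (Real.exp_pos _).le]
    exact Finset.prod_congr rfl fun k _ => hfg k
  apply le_antisymm
  · rw [ENNReal.tsum_eq_iSup_sum]
    refine iSup_le fun T => ?_
    calc ∑ n ∈ T, ∏ k ∈ n.support, f k (n k)
        = ∑ n ∈ T, (if n.support ⊆ T.biUnion (fun n => n.support) then
            ∏ k ∈ T.biUnion (fun n => n.support), f k (n k) else 0) := by
          refine Finset.sum_congr rfl fun n hn => ?_
          have h : n.support ⊆ T.biUnion (fun n => n.support) :=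
            Finset.subset_biUnion_of_mem (fun n : ι →₀ ℕ => n.support) hn
          rw [if_pos h, hprod _ _ h]
      _ ≤ _ := ENNReal.sum_le_tsum _
      _ = _ := hpart _
      _ ≤ _ := ENNReal.ofReal_le_ofReal (Real.exp_le_exp.mpr (hg.sum_le_tsum _ fun k _ => hg0 k))
  · have hlim : Tendsto (fun s : Finset ι => ENNReal.ofReal (Real.exp (∑ k ∈ s, g k))) atTop
        (𝓝 (ENNReal.ofReal (Real.exp (∑' k, g k)))) :=
      (ENNReal.continuous_ofReal.comp Real.continuous_exp).continuousAt.tendsto.comp hg.hasSum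
    refine le_of_tendsto' hlim fun s => ?_
    rw [← hpart s]
    refine ENNReal.tsum_le_tsum fun n => ?_
    split_ifs with h
    · exact (hprod _ _ h).le
    · exact zero_le

/-- The multiset of all cycle lengths of a permutation of `Fin n`, fixed points included. -/
def cycleLengths {n : ℕ} (π : Equiv.Perm (Fin n)) : Multiset ℕ :=
  π.cycleType + Multiset.replicate (n - π.cycleType.sum) 1

theorem cycleType_sum_le {n : ℕ} (π : Equiv.Perm (Fin n)) : π.cycleType.sum ≤ n := by
  rw [Equiv.Perm.sum_cycleType]
  simpa using Finset.card_le_univ π.support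

theorem count_cycleType_eq_zero {n : ℕ} (π : Equiv.Perm (Fin n)) {j : ℕ} (hj : j < 2) :
    Multiset.count j π.cycleType = 0 :=
  Multiset.count_eq_zero.mpr fun h => by
    have := Equiv.Perm.two_le_of_mem_cycleType h
    omega

theorem cycleLengths_sum {n : ℕ} (π : Equiv.Perm (Fin n)) : (cycleLengths π).sum = n := by
  have := cycleType_sum_le π
  simp [cycleLengths]
  omega

theorem zero_notMem_cycleLengths {n : ℕ} (π : Equiv.Perm (Fin n)) : 0 ∉ cycleLengths π := by
  rw [← Multiset.count_eq_zero, cycleLengths, Multiset.count_add,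
    count_cycleType_eq_zero π (by norm_num), Multiset.count_replicate]
  simp

theorem count_cycleLengths {n : ℕ} (π : Equiv.Perm (Fin n)) (j : ℕ) :
    Multiset.count j (cycleLengths π) = cycCount π j := by
  rw [cycleLengths, Multiset.count_add, Multiset.count_replicate, cycCount]
  by_cases hj : j = 1
  · subst hj
    simp [count_cycleType_eq_zero π (show 1 < 2 by norm_num)]
  · rw [if_neg (Ne.symm hj), if_neg hj, add_zero]

/-- Decomposition of a multiset of positive integers into its parts `≥ 2` and its ones. -/
theorem filter_two_le_add_replicate {M : Multiset ℕ} (h0 : 0 ∉ M) :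
    M.filter (2 ≤ ·) + Multiset.replicate (M.count 1) 1 = M := by
  ext j
  rw [Multiset.count_add, Multiset.count_filter, Multiset.count_replicate]
  rcases lt_trichotomy j 1 with h | h | h
  · obtain rfl : j = 0 := by omega
    simp [Multiset.count_eq_zero.mpr h0]
  · subst h
    simp
  · rw [if_pos (by omega), if_neg (by omega), add_zero]

theorem cycleLengths_eq_iff {n : ℕ} (π : Equiv.Perm (Fin n)) {M : Multiset ℕ} (h0 : 0 ∉ M)
    (hM : M.sum = n) : cycleLengths π = M ↔ π.cycleType = M.filter (2 ≤ ·) := by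
  have hdec := filter_two_le_add_replicate h0
  have hsum : (M.filter (2 ≤ ·)).sum + M.count 1 = n := by
    conv_rhs => rw [← hM, ← hdec]
    simp
  constructor
  · intro h
    rw [← h, cycleLengths, Multiset.filter_add, Multiset.filter_eq_self.mpr
      fun j hj => Equiv.Perm.two_le_of_mem_cycleType hj]
    rw [Multiset.filter_eq_nil.mpr, add_zero]
    intro j hj
    rw [Multiset.eq_of_mem_replicate hj]
    norm_num
  · intro h
    rw [cycleLengths, h]
    conv_rhs => rw [← hdec]
    congr 2
    omega

/-- The number of permutations with given cycle lengths. -/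
theorem card_cycleLengths_eq_mul {n : ℕ} {M : Multiset ℕ} (h0 : 0 ∉ M) :
    (Finset.univ.filter fun π : Equiv.Perm (Fin n) => cycleLengths π = M).card *
      (M.prod * ∏ j ∈ M.toFinset, (M.count j).factorial) =
      if M.sum = n then n.factorial else 0 := by
  split_ifs with hM
  · have hdec := filter_two_le_add_replicate h0
    have hsum : (M.filter (2 ≤ ·)).sum + M.count 1 = n := by
      conv_rhs => rw [← hM, ← hdec]
      simp
    have hprod : M.prod = (M.filter (2 ≤ ·)).prod := by
      conv_lhs => rw [← hdec]
      simp
    have hfac : ∏ j ∈ M.toFinset, (M.count j).factorial =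
        (M.count 1).factorial * ∏ j ∈ (M.filter (2 ≤ ·)).toFinset,
          ((M.filter (2 ≤ ·)).count j).factorial := by
      have h1 : ∏ j ∈ M.toFinset, (M.count j).factorial =
          ∏ j ∈ insert 1 (M.filter (2 ≤ ·)).toFinset, (M.count j).factorial := by
        refine Finset.prod_subset (fun j hj => ?_) fun j _ hj => ?_
        · rw [Multiset.mem_toFinset] at hj
          rw [Finset.mem_insert, Multiset.mem_toFinset, Multiset.mem_filter]
          have : j ≠ 0 := by rintro rfl; exact h0 hj
          by_cases h : j = 1
          · exact Or.inl h
          · exact Or.inr ⟨hj, by omega⟩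
        · rw [Multiset.mem_toFinset] at hj
          simp [Multiset.count_eq_zero.mpr hj]
      rw [h1, Finset.prod_insert (by simp)]
      congr 1
      refine Finset.prod_congr rfl fun j hj => ?_
      rw [Multiset.mem_toFinset, Multiset.mem_filter] at hj
      rw [Multiset.count_filter, if_pos hj.2]
    have hcard := Equiv.Perm.card_of_cycleType_mul_eq (Fin n) (M.filter (2 ≤ ·))
    rw [Fintype.card_fin, if_pos ⟨by omega, fun j hj => (Multiset.mem_filter.mp hj).2⟩,
      show n - (M.filter (2 ≤ ·)).sum = M.count 1 by omega] at hcard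
    simp_rw [cycleLengths_eq_iff _ h0 hM]
    rw [hprod, hfac, ← hcard]
    convert! (rfl : _ = _) using 1
    ring
  · rw [Finset.filter_eq_empty_iff.mpr, Finset.card_empty, zero_mul]
    rintro π - rfl
    exact hM (cycleLengths_sum π)

theorem permWeight_eq_prod (α : ℕ → ℝ) {n : ℕ} (π : Equiv.Perm (Fin n)) :
    permWeight α π = ∏ j ∈ (cycleLengths π).toFinset,
      Real.exp (-α j) ^ (cycleLengths π).count j := by
  rw [permWeight, ← Finset.sum_neg_distrib, Real.exp_sum]
  have h : ∀ j, Real.exp (-(α j * (cycCount π j : ℝ))) =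
      Real.exp (-α j) ^ (cycleLengths π).count j := by
    intro j
    rw [count_cycleLengths, ← Real.exp_nat_mul]
    congr 1
    ring
  simp_rw [h]
  refine (Finset.prod_subset (fun j hj => ?_) fun j _ hj => ?_).symm
  · rw [Multiset.mem_toFinset] at hj
    have h1 := Multiset.le_sum_of_mem hj
    rw [cycleLengths_sum] at h1
    have : j ≠ 0 := by rintro rfl; exact zero_notMem_cycleLengths π hj
    exact Finset.mem_Icc.mpr ⟨by omega, h1⟩
  · rw [Multiset.mem_toFinset] at hj
    rw [Multiset.count_eq_zero.mpr hj, pow_zero]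

/-- The weight of a multiset of cycle lengths in the exponential formula. -/
def cycleLengthsWeight (α : ℕ → ℝ) (x : ℝ) (M : Multiset ℕ) : ℝ :=
  ∏ j ∈ M.toFinset, (Real.exp (-α j) * x ^ j / j) ^ M.count j / (M.count j).factorial

theorem card_cycleLengths_mul_weight (α : ℕ → ℝ) (x : ℝ) (n : ℕ) (M : Multiset ℕ) :
    ((Finset.univ.filter fun π : Equiv.Perm (Fin n) => cycleLengths π = M).card : ℝ) *
      (x ^ n * ((n.factorial : ℝ)⁻¹ * ∏ j ∈ M.toFinset, Real.exp (-α j) ^ M.count j)) =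
      if M.sum = n then cycleLengthsWeight α x M else 0 := by
  by_cases h0 : 0 ∈ M
  · have hw : cycleLengthsWeight α x M = 0 := by
      refine Finset.prod_eq_zero (Multiset.mem_toFinset.mpr h0) ?_
      simp [Multiset.count_eq_zero, h0]
    rw [hw, ite_self, Finset.filter_eq_empty_iff.mpr, Finset.card_empty, Nat.cast_zero, zero_mul]
    rintro π - rfl
    exact zero_notMem_cycleLengths π h0
  have hcard := congrArg (Nat.cast : ℕ → ℝ) (card_cycleLengths_eq_mul (n := n) h0)
  simp only [Nat.cast_mul, Nat.cast_prod, Nat.cast_ite, Nat.cast_zero] at hcard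
  have hMprod : (M.prod : ℝ) ≠ 0 := by
    exact_mod_cast fun h => h0 (Multiset.prod_eq_zero_iff.mp h)
  have hfac : ∏ j ∈ M.toFinset, ((M.count j).factorial : ℝ) ≠ 0 :=
    Finset.prod_ne_zero_iff.mpr fun j _ => by positivity
  have hn : (n.factorial : ℝ) ≠ 0 := by positivity
  split_ifs at hcard ⊢ with hM
  · have hx : x ^ n = ∏ j ∈ M.toFinset, (x ^ j) ^ M.count j := by
      rw [← hM, Finset.sum_multiset_count, ← Finset.prod_pow_eq_pow_sum]
      refine Finset.prod_congr rfl fun j _ => ?_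
      rw [← pow_mul, smul_eq_mul, mul_comm]
    have hp : (M.prod : ℝ) = ∏ j ∈ M.toFinset, (j : ℝ) ^ M.count j := by
      rw [Finset.prod_multiset_count]
      push_cast
      rfl
    have hw : cycleLengthsWeight α x M =
        (∏ j ∈ M.toFinset, Real.exp (-α j) ^ M.count j) * x ^ n /
          (M.prod * ∏ j ∈ M.toFinset, ((M.count j).factorial : ℝ)) := by
      rw [hx, hp, ← Finset.prod_mul_distrib, ← Finset.prod_mul_distrib, ← Finset.prod_div_distrib]
      refine Finset.prod_congr rfl fun j _ => ?_
      rw [div_pow, mul_pow, div_div]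
    rw [hw, eq_div_iff (mul_ne_zero hMprod hfac)]
    linear_combination
      (x ^ n * (n.factorial : ℝ)⁻¹ * ∏ j ∈ M.toFinset, Real.exp (-α j) ^ M.count j) * hcard +
        (x ^ n * ∏ j ∈ M.toFinset, Real.exp (-α j) ^ M.count j) * mul_inv_cancel₀ hn
  · have hz : ((Finset.univ.filter fun π : Equiv.Perm (Fin n) => cycleLengths π = M).card : ℝ) = 0 :=
      (mul_eq_zero.mp hcard).resolve_right (mul_ne_zero hMprod hfac)
    rw [hz, zero_mul]

/-- The generating function of the `hcoef` as a sum over multisets of cycle lengths. -/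
theorem tsum_hcoef_eq_tsum_multiset (α : ℕ → ℝ) {x : ℝ} (hx : 0 ≤ x) :
    ∑' n : ℕ, ENNReal.ofReal (x ^ n * hcoef α n) =
      ∑' M : Multiset ℕ, ENNReal.ofReal (cycleLengthsWeight α x M) := by
  have hV : ∀ M : Multiset ℕ, 0 ≤ ∏ j ∈ M.toFinset, Real.exp (-α j) ^ M.count j := fun M =>
    Finset.prod_nonneg fun j _ => by positivity
  have hn : ∀ n : ℕ, ENNReal.ofReal (x ^ n * hcoef α n) =
      ∑' M : Multiset ℕ, if M.sum = n then ENNReal.ofReal (cycleLengthsWeight α x M) else 0 := by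
    intro n
    let c : Multiset ℕ → ℝ := fun M =>
      x ^ n * ((n.factorial : ℝ)⁻¹ * ∏ j ∈ M.toFinset, Real.exp (-α j) ^ M.count j)
    have hc : ∀ M, 0 ≤ c M := fun M => by
      have := hV M
      positivity
    have h1 : x ^ n * hcoef α n = ∑ π : Equiv.Perm (Fin n), c (cycleLengths π) := by
      rw [hcoef, Finset.mul_sum, Finset.mul_sum]
      exact Finset.sum_congr rfl fun π _ => by rw [permWeight_eq_prod]
    have h2 : ∀ π : Equiv.Perm (Fin n), ENNReal.ofReal (c (cycleLengths π)) =
        ∑' M, if cycleLengths π = M then ENNReal.ofReal (c M) else 0 := fun π =>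
      (tsum_ite_eq' (cycleLengths π) fun M => ENNReal.ofReal (c M)).symm
    rw [h1, ENNReal.ofReal_sum_of_nonneg fun π _ => hc _, Finset.sum_congr rfl fun π _ => h2 π,
      ← Summable.tsum_finsetSum fun _ _ => ENNReal.summable]
    refine tsum_congr fun M => ?_
    rw [← Finset.sum_filter, Finset.sum_const, nsmul_eq_mul, ← ENNReal.ofReal_natCast,
      ← ENNReal.ofReal_mul (Nat.cast_nonneg _), card_cycleLengths_mul_weight]
    split_ifs <;> simp
  simp_rw [hn]
  rw [ENNReal.tsum_comm]
  exact tsum_congr fun M => tsum_ite_eq' M.sum fun _ => ENNReal.ofReal (cycleLengthsWeight α x M)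

/-- The exponential formula: the generating function of the `hcoef`. -/
theorem tsum_hcoef_eq_exp (α : ℕ → ℝ) {x : ℝ} (hx : 0 ≤ x)
    (hs : Summable fun j : ℕ => Real.exp (-α j) * x ^ j / j) :
    ∑' n : ℕ, ENNReal.ofReal (x ^ n * hcoef α n) =
      ENNReal.ofReal (Real.exp (∑' j : ℕ, Real.exp (-α j) * x ^ j / j)) := by
  have hg : ∀ j : ℕ, 0 ≤ Real.exp (-α j) * x ^ j / j := fun j => by positivity
  rw [tsum_hcoef_eq_tsum_multiset α hx, ← tsum_finsupp_prod_eq_exp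
    (fun (j : ℕ) m => ENNReal.ofReal ((Real.exp (-α j) * x ^ j / j) ^ m / m.factorial)) (by simp)
    (fun j => Real.exp (-α j) * x ^ j / j) hg hs]
  · rw [← Multiset.toFinsupp.toEquiv.tsum_eq]
    refine tsum_congr fun M => ?_
    rw [cycleLengthsWeight, ENNReal.ofReal_prod_of_nonneg fun j _ => by
      have := hg j
      positivity]
    simp
  · intro j
    rw [← ENNReal.ofReal_tsum_of_nonneg (fun m => by have := hg j; positivity)
      (Real.summable_pow_div_factorial _), Real.exp_eq_exp_ℝ, NormedSpace.exp_eq_tsum_div]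

/-- The exponent in the exponential formula: `∑_{j≥1} e^{-α_j} x^j / j`. -/
def cycleSeries (α : ℕ → ℝ) (x : ℝ) : ℝ :=
  ∑' j : ℕ, Real.exp (-α j) * x ^ j / j

/-- The logarithmic derivative `∑_{j≥1} e^{-α_j} x^j` of `cycleSeries`. -/
def cycleSeriesDeriv (α : ℕ → ℝ) (x : ℝ) : ℝ :=
  ∑' j : ℕ, Real.exp (-α (j + 1)) * x ^ (j + 1)

theorem cycleSeries_zero (α : ℕ → ℝ) : cycleSeries α 0 = 0 := by
  rw [cycleSeries, ← tsum_zero]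
  refine tsum_congr fun j => ?_
  rcases j with _ | j <;> simp

theorem cycleSeriesDeriv_zero (α : ℕ → ℝ) : cycleSeriesDeriv α 0 = 0 := by
  simp [cycleSeriesDeriv]

theorem cycleSeries_nonneg (α : ℕ → ℝ) {x : ℝ} (hx0 : 0 ≤ x) : 0 ≤ cycleSeries α x :=
  tsum_nonneg fun j => by positivity

theorem cycleSeries_term_le {α : ℕ → ℝ} {C : ℝ}
    (hC : ∀ j : ℕ, 1 ≤ j → Real.exp (-α j) ≤ C) {x : ℝ} (hx0 : 0 ≤ x) (j : ℕ) :
    Real.exp (-α (j + 1)) * x ^ (j + 1) / ((j + 1 : ℕ) : ℝ) ≤ C * x * x ^ j := by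
  have h := hC (j + 1) (by omega)
  have h1 : Real.exp (-α (j + 1)) * x ^ (j + 1) / ((j + 1 : ℕ) : ℝ) ≤
      Real.exp (-α (j + 1)) * x ^ (j + 1) :=
    div_le_self (by positivity) (by simp)
  calc _ ≤ _ := h1
    _ ≤ C * x ^ (j + 1) := by gcongr
    _ = _ := by ring

theorem summable_cycleSeries {α : ℕ → ℝ} {C : ℝ}
    (hC : ∀ j : ℕ, 1 ≤ j → Real.exp (-α j) ≤ C) {x : ℝ} (hx0 : 0 ≤ x) (hx1 : x < 1) :
    Summable fun j : ℕ => Real.exp (-α j) * x ^ j / j := by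
  rw [← summable_nat_add_iff 1]
  exact Summable.of_nonneg_of_le (fun j => by positivity) (cycleSeries_term_le hC hx0)
    ((summable_geometric_of_lt_one hx0 hx1).mul_left _)

theorem cycleSeries_le {α : ℕ → ℝ} {C : ℝ}
    (hC : ∀ j : ℕ, 1 ≤ j → Real.exp (-α j) ≤ C) {x : ℝ} (hx0 : 0 ≤ x) (hx1 : x < 1) :
    cycleSeries α x ≤ C * x * (1 - x)⁻¹ := by
  have hs := summable_cycleSeries hC hx0 hx1
  rw [cycleSeries, hs.tsum_eq_zero_add, ← tsum_geometric_of_lt_one hx0 hx1, ← tsum_mul_left]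
  simp only [Nat.cast_zero, _root_.div_zero, zero_add]
  exact ((summable_nat_add_iff 1).mpr hs).tsum_le_tsum (cycleSeries_term_le hC hx0)
    ((summable_geometric_of_lt_one hx0 hx1).mul_left _)

theorem summable_cycleSeries_comp {α : ℕ → ℝ} {C : ℝ}
    (hC : ∀ j : ℕ, 1 ≤ j → Real.exp (-α j) ≤ C) {ι : Type*} {v : ι → ℝ} {θ : ℝ} (hv0 : ∀ k, 0 ≤ v k)
    (hvθ : ∀ k, v k ≤ θ) (hθ : θ < 1) (hv : Summable v) :
    Summable fun k => cycleSeries α (v k) := by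
  have hC0 : 0 ≤ C := (Real.exp_pos _).le.trans (hC 1 le_rfl)
  refine Summable.of_nonneg_of_le (fun k => cycleSeries_nonneg α (hv0 k)) (fun k => ?_)
    (hv.mul_left (C * (1 - θ)⁻¹))
  have h1 : (1 - v k)⁻¹ ≤ (1 - θ)⁻¹ := inv_anti₀ (by linarith) (by linarith [hvθ k])
  calc cycleSeries α (v k) ≤ C * v k * (1 - v k)⁻¹ :=
        cycleSeries_le hC (hv0 k) ((hvθ k).trans_lt hθ)
    _ ≤ C * v k * (1 - θ)⁻¹ := by
        have := hv0 k
        gcongr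
    _ = _ := by ring

/-- The grand-canonical partition function with fugacities `v` factorizes. -/
theorem tsum_occupation_eq_exp {α : ℕ → ℝ} {C : ℝ}
    (hC : ∀ j : ℕ, 1 ≤ j → Real.exp (-α j) ≤ C) {ι : Type*} {v : ι → ℝ} {θ : ℝ} (hv0 : ∀ k, 0 ≤ v k)
    (hvθ : ∀ k, v k ≤ θ) (hθ : θ < 1) (hv : Summable v) :
    ∑' n : ι →₀ ℕ, ∏ k ∈ n.support, ENNReal.ofReal (v k ^ n k * hcoef α (n k)) =
      ENNReal.ofReal (Real.exp (∑' k, cycleSeries α (v k))) :=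
  tsum_finsupp_prod_eq_exp (fun k m => ENNReal.ofReal (v k ^ m * hcoef α m))
    (fun k => by simp [hcoef, permWeight]) _ (fun k => cycleSeries_nonneg α (hv0 k))
    (summable_cycleSeries_comp hC hv0 hvθ hθ hv)
    fun k => tsum_hcoef_eq_exp α (hv0 k)
      (summable_cycleSeries hC (hv0 k) ((hvθ k).trans_lt hθ))

theorem summable_prod_cycleSeriesDeriv {α : ℕ → ℝ} {C : ℝ}
    (hC : ∀ j : ℕ, 1 ≤ j → Real.exp (-α j) ≤ C) {ι : Type*} {v : ι → ℝ} {θ : ℝ} (hv0 : ∀ k, 0 ≤ v k)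
    (hvθ : ∀ k, v k ≤ θ) (hθ0 : 0 ≤ θ) (hθ : θ < 1) (hv : Summable v) :
    Summable fun p : ℕ × ι => Real.exp (-α (p.1 + 1)) * v p.2 ^ (p.1 + 1) := by
  have hC0 : 0 ≤ C := (Real.exp_pos _).le.trans (hC 1 le_rfl)
  refine Summable.of_nonneg_of_le (fun p => ?_) (fun p => ?_)
    (((summable_geometric_of_lt_one hθ0 hθ).mul_of_nonneg hv (fun j => pow_nonneg hθ0 j)
      hv0).mul_left C)
  · have := hv0 p.2
    positivity
  · have h0 := hv0 p.2
    have h1 : v p.2 ^ p.1 ≤ θ ^ p.1 := pow_le_pow_left₀ h0 (hvθ p.2) _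
    rw [pow_succ]
    have h2 := hC (p.1 + 1) (by omega)
    gcongr

/-- Second-order Taylor estimate for `s ↦ cycleSeries α (e^{-e+s})` at `s = 0`. -/
theorem abs_cycleSeries_sub_le {α : ℕ → ℝ} {C : ℝ}
    (hC : ∀ j : ℕ, 1 ≤ j → Real.exp (-α j) ≤ C) {e t : ℝ} (he : 0 < e) (ht : |t| ≤ e / 2) (ht1 : |t| ≤ 1) :
    |cycleSeries α (Real.exp (-e) * Real.exp t) - cycleSeries α (Real.exp (-e)) -
      t * cycleSeriesDeriv α (Real.exp (-e))| ≤
      C * t ^ 2 * (3 * Real.exp (-e) * (1 + 2 / e) ^ 2) := by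
  have hC0 : 0 ≤ C := (Real.exp_pos _).le.trans (hC 1 le_rfl)
  set u := Real.exp (-e) with hu
  set r := Real.exp (-(e - |t|)) with hr
  have hru : r = u * Real.exp |t| := by rw [hr, hu, ← Real.exp_add]; congr 1; ring
  have hu0 : 0 < u := Real.exp_pos _
  have hr0 : 0 < r := Real.exp_pos _
  have hrhalf : r ≤ Real.exp (-(e / 2)) := Real.exp_le_exp.mpr (by linarith)
  have hu1 : u < 1 := by rw [hu, Real.exp_lt_one_iff]; linarith
  have hut1 : u * Real.exp t < 1 := by
    rw [hu, ← Real.exp_add, Real.exp_lt_one_iff]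
    linarith [le_abs_self t]
  have hgap : e / (2 + e) ≤ 1 - r := by
    have h1 : Real.exp (-(e / 2)) ≤ (1 + e / 2)⁻¹ := by
      rw [Real.exp_neg]
      exact inv_anti₀ (by positivity) (by linarith [Real.add_one_le_exp (e / 2)])
    have h2 : (1 + e / 2)⁻¹ = 1 - e / (2 + e) := by
      field_simp
      ring
    linarith
  have hr1 : r < 1 := by
    have : 0 < e / (2 + e) := by positivity
    linarith
  have hs1 := summable_cycleSeries hC (mul_pos hu0 (Real.exp_pos t)).le hut1
  have hs0 := summable_cycleSeries hC hu0.le hu1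
  have hsd' : Summable fun j : ℕ => Real.exp (-α (j + 1)) * u ^ (j + 1) := by
    refine Summable.of_nonneg_of_le (fun j => by positivity) (fun j => ?_)
      ((summable_geometric_of_lt_one hu0.le hu1).mul_left (C * u))
    have := hC (j + 1) (by omega)
    calc _ ≤ C * u ^ (j + 1) := by gcongr
      _ = _ := by ring
  have hsd : HasSum (fun j : ℕ => (j : ℝ) * (Real.exp (-α j) * u ^ j / j))
      (cycleSeriesDeriv α u) := by
    rw [← hasSum_nat_add_iff' 1]
    simp only [Finset.range_one, Finset.sum_singleton, Nat.cast_zero, zero_mul, sub_zero]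
    convert! hsd'.hasSum using 1
    ext j
    have : ((j + 1 : ℕ) : ℝ) ≠ 0 := by positivity
    field_simp
  have hD := ((hs1.hasSum.sub hs0.hasSum).sub (hsd.mul_left t))
  have hgeom := (hasSum_coe_mul_geometric_of_norm_lt_one
    (show ‖r‖ < 1 by rwa [Real.norm_of_nonneg hr0.le])).mul_left (C * t ^ 2)
  have hterm : ∀ j : ℕ, ‖Real.exp (-α j) * (u * Real.exp t) ^ j / j -
      Real.exp (-α j) * u ^ j / j - t * ((j : ℝ) * (Real.exp (-α j) * u ^ j / j))‖ ≤
      C * t ^ 2 * (j * r ^ j) := by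
    intro j
    rcases Nat.eq_zero_or_pos j with rfl | hj
    · simp
    have hj' : (0 : ℝ) < j := by exact_mod_cast hj
    have hexp : |Real.exp (j * t) - 1 - j * t| ≤ (j * t) ^ 2 * Real.exp (j * |t|) := by
      have h := Complex.norm_exp_sub_sum_le_norm_mul_exp ((j * t : ℝ) : ℂ) 2
      simp only [Finset.sum_range_succ, Finset.sum_range_zero] at h
      have h' : Complex.exp ((j * t : ℝ) : ℂ) - (0 + ((j * t : ℝ) : ℂ) ^ 0 / (Nat.factorial 0 : ℕ) +
          ((j * t : ℝ) : ℂ) ^ 1 / (Nat.factorial 1 : ℕ)) =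
          ((Real.exp (j * t) - 1 - j * t : ℝ) : ℂ) := by
        push_cast
        simp
        ring
      rw [h', Complex.norm_real, Complex.norm_real, Real.norm_eq_abs, Real.norm_eq_abs, sq_abs,
        abs_mul, Nat.abs_cast] at h
      exact h
    have heq : Real.exp (-α j) * (u * Real.exp t) ^ j / j -
        Real.exp (-α j) * u ^ j / j - t * ((j : ℝ) * (Real.exp (-α j) * u ^ j / j)) =
        Real.exp (-α j) * u ^ j / j * (Real.exp (j * t) - 1 - j * t) := by
      rw [mul_pow, Real.exp_nat_mul t j]
      ring
    rw [heq, norm_mul, Real.norm_of_nonneg (by positivity), Real.norm_eq_abs]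
    calc _ ≤ C * u ^ j / j * ((j * t) ^ 2 * Real.exp (j * |t|)) := by
          have := hC j hj
          gcongr
      _ = C * t ^ 2 * (j * r ^ j) := by
          rw [hru, mul_pow, Real.exp_nat_mul |t| j]
          field_simp
          ring
  have hbound := tsum_of_norm_bounded hgeom hterm
  rw [hD.tsum_eq, Real.norm_eq_abs] at hbound
  refine hbound.trans ?_
  gcongr
  have h3 : r ≤ 3 * u := by
    rw [hru, mul_comm]
    gcongr
    exact (Real.exp_le_exp.mpr ht1).trans (by linarith [Real.exp_one_lt_d9])
  have h4 : (1 + 2 / e) ^ 2 = ((e / (2 + e)) ^ 2)⁻¹ := by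
    field_simp
    ring
  rw [h4, div_eq_mul_inv]
  gcongr

/-- The Boltzmann factor of a nonzero mode, and `0` for the zero mode. -/
def boltzmann (d : ℕ) (ε : Eu d → ℝ) (L : ℝ) (z : Fin d → ℤ) : ℝ :=
  if z = 0 then 0 else Real.exp (-ε (dualPt d L z))

theorem boltzmann_nonneg (d : ℕ) (ε : Eu d → ℝ) (L : ℝ) (z : Fin d → ℤ) :
    0 ≤ boltzmann d ε L z := by
  rw [boltzmann]
  split_ifs <;> positivity

theorem boltzmann_le (d : ℕ) (ε : Eu d → ℝ) (L : ℝ) (z : Fin d → ℤ) :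
    boltzmann d ε L z ≤ Real.exp (-ε (dualPt d L z)) := by
  rw [boltzmann]
  split_ifs
  · positivity
  · rfl

theorem hcoef_nonneg (α : ℕ → ℝ) (n : ℕ) : 0 ≤ hcoef α n :=
  mul_nonneg (by positivity) (Finset.sum_nonneg fun _ _ => (Real.exp_pos _).le)

/-- The exponential moments of the particle number in terms of occupation numbers. -/
theorem tsum_Zcheck_mul_exp (d : ℕ) (ε : Eu d → ℝ) (α : ℕ → ℝ) (L t c : ℝ) :
    ∑' N : ℕ, Zcheck d ε α L N * ENNReal.ofReal (Real.exp (t * N - c)) =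
      ENNReal.ofReal (Real.exp (-c)) * ∑' n : (Fin d → ℤ) →₀ ℕ, ∏ k ∈ n.support,
        ENNReal.ofReal ((boltzmann d ε L k * Real.exp t) ^ n k * hcoef α (n k)) := by
  simp_rw [Zcheck, ← ENNReal.tsum_mul_right]
  rw [ENNReal.tsum_comm, ← ENNReal.tsum_mul_left]
  refine tsum_congr fun n => ?_
  rw [tsum_eq_single (n.sum fun _ m => m) fun N hN => by
    rw [if_neg fun h => hN h.1.symm, zero_mul]]
  by_cases h0 : n 0 = 0
  · rw [if_pos ⟨rfl, h0⟩, sub_eq_neg_add, Real.exp_add, ENNReal.ofReal_mul (Real.exp_pos _).le,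
      mul_left_comm, Finsupp.sum, Nat.cast_sum, Finset.mul_sum, Real.exp_sum,
      ENNReal.ofReal_prod_of_nonneg fun k _ => (Real.exp_pos _).le, ← Finset.prod_mul_distrib]
    congr 1
    refine Finset.prod_congr rfl fun k hk => ?_
    have hk0 : k ≠ 0 := by
      rintro rfl
      exact Finsupp.mem_support_iff.mp hk h0
    rw [← ENNReal.ofReal_mul (mul_nonneg (Real.exp_pos _).le (hcoef_nonneg α _)), boltzmann,
      if_neg hk0, ← Real.exp_add, ← Real.exp_nat_mul, mul_right_comm, ← Real.exp_add]
    congr 3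
    ring
  · rw [if_neg fun h => h0 h.2, zero_mul, Finset.prod_eq_zero (Finsupp.mem_support_iff.mpr h0),
      mul_zero]
    simp [boltzmann, h0]

/-- Exact formula for the exponential moments of the normalized particle number. -/
theorem exponential_moment_eq (d : ℕ) (ε : Eu d → ℝ) (α : ℕ → ℝ) {C : ℝ}
    (hC : ∀ j : ℕ, 1 ≤ j → Real.exp (-α j) ≤ C) {L θ t l : ℝ} (hL : 0 < L) (hl : t = l / L ^ d)
    (hsum : Summable fun z => boltzmann d ε L z) (hθ0 : 0 ≤ θ) (hθ : θ < 1)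
    (hu : ∀ z, boltzmann d ε L z ≤ θ) (hut : ∀ z, boltzmann d ε L z * Real.exp t ≤ θ) :
    (∑' N : ℕ, Zcheck d ε α L N *
      ENNReal.ofReal (Real.exp (l * ((N : ℝ) / L ^ d - rhoCL d ε α L)))) /
        (∑' N : ℕ, Zcheck d ε α L N) =
      ENNReal.ofReal (Real.exp (∑' z, (cycleSeries α (boltzmann d ε L z * Real.exp t) -
        cycleSeries α (boltzmann d ε L z) - t * cycleSeriesDeriv α (boltzmann d ε L z)))) := by
  have hu0 := boltzmann_nonneg d ε L
  have hut0 : ∀ z, 0 ≤ boltzmann d ε L z * Real.exp t := fun z =>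
    mul_nonneg (hu0 z) (Real.exp_pos _).le
  have hLd : (0 : ℝ) < L ^ d := pow_pos hL d
  have hnum : ∀ N : ℕ, l * ((N : ℝ) / L ^ d - rhoCL d ε α L) = t * N - l * rhoCL d ε α L := by
    intro N
    rw [hl]
    ring
  have hsprod := summable_prod_cycleSeriesDeriv hC hu0 hu hθ0 hθ hsum
  have hrho : l * rhoCL d ε α L = t * ∑' z, cycleSeriesDeriv α (boltzmann d ε L z) := by
    have h1 : ∀ (j : ℕ) (z : Fin d → ℤ),
        (if z = 0 then 0 else Real.exp (-(((j : ℝ) + 1) * ε (dualPt d L z)))) =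
          boltzmann d ε L z ^ (j + 1) := by
      intro j z
      rw [boltzmann]
      split_ifs
      · simp
      · rw [← Real.exp_nat_mul]
        congr 1
        push_cast
        ring
    have h2 : rhoCL d ε α L = (L ^ d)⁻¹ * ∑' z, cycleSeriesDeriv α (boltzmann d ε L z) := by
      rw [rhoCL]
      simp_rw [h1, cycleSeriesDeriv, mul_left_comm _ ((L ^ d)⁻¹) _, tsum_mul_left]
      congr 1
      simp_rw [← tsum_mul_left]
      exact hsprod.tsum_comm.symm
    rw [h2, hl]
    ring
  have hs1 := summable_cycleSeries_comp hC hut0 hut hθ (hsum.mul_right _)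
  have hs0 := summable_cycleSeries_comp hC hu0 hu hθ hsum
  have hsd : Summable fun z => cycleSeriesDeriv α (boltzmann d ε L z) :=
    hsprod.prod_symm.prod
  have hden : ∑' N : ℕ, Zcheck d ε α L N =
      ENNReal.ofReal (Real.exp (∑' z, cycleSeries α (boltzmann d ε L z))) := by
    have h := tsum_Zcheck_mul_exp d ε α L 0 0
    simp only [zero_mul, sub_zero, Real.exp_zero, ENNReal.ofReal_one, mul_one, neg_zero,
      one_mul] at h
    rw [h, tsum_occupation_eq_exp hC hu0 hu hθ hsum]
  simp_rw [hnum]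
  rw [tsum_Zcheck_mul_exp, tsum_occupation_eq_exp hC hut0 hut hθ (hsum.mul_right _), hden,
    ← ENNReal.ofReal_mul (Real.exp_pos _).le, ← ENNReal.ofReal_div_of_pos (Real.exp_pos _),
    ← Real.exp_add, ← Real.exp_sub, hrho, (hs1.sub hs0).tsum_sub (hsd.mul_left t),
    hs1.tsum_sub hs0, tsum_mul_left]
  congr 2
  ring

/-- Convergence of the lattice sums `∑_{z ∈ ℤ^d} ‖z‖^{-s}` for `s > d`. -/
theorem summable_norm_int_rpow (d : ℕ) {s : ℝ} (hs : s < -d) :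
    Summable fun z : Fin d → ℤ => ‖z‖ ^ s := by
  let b := Pi.basisFun ℝ (Fin d)
  let Λ := Submodule.span ℤ (Set.range b)
  have hr : Module.finrank ℤ Λ = d := by
    rw [ZLattice.rank ℝ Λ]
    simp
  have h := ZLattice.summable_norm_rpow Λ s (by rwa [hr])
  have hmem : ∀ z : Fin d → ℤ, (fun i => (z i : ℝ)) ∈ Λ := fun z =>
    (b.mem_span_iff_repr_mem ℤ _).mpr fun i => ⟨z i, by simp [b]⟩
  have hinj : Function.Injective fun z : Fin d → ℤ => (⟨_, hmem z⟩ : Λ) := by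
    intro z z' hz
    ext i
    have hi : (z i : ℝ) = z' i := congrFun (congrArg Subtype.val hz) i
    exact_mod_cast hi
  refine (h.comp_injective hinj).congr fun z => ?_
  congr 1

theorem norm_int_div_le_norm_dualPt (d : ℕ) {L : ℝ} (hL : 0 < L) (z : Fin d → ℤ) :
    ‖z‖ / L ≤ ‖dualPt d L z‖ := by
  rw [div_le_iff₀ hL, pi_norm_le_iff_of_nonneg (by positivity)]
  intro i
  have h := PiLp.norm_apply_le (dualPt d L z) i
  have hi : dualPt d L z i = z i / L := rfl
  rw [hi, norm_div, Real.norm_of_nonneg hL.le, div_le_iff₀ hL] at h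
  rw [Int.norm_eq_abs]
  simpa using h

theorem one_le_norm_int {d : ℕ} {z : Fin d → ℤ} (hz : z ≠ 0) : 1 ≤ ‖z‖ := by
  obtain ⟨i, hi⟩ := Function.ne_iff.mp hz
  refine le_trans ?_ (norm_le_pi_norm z i)
  rw [Int.norm_eq_abs]
  exact_mod_cast Int.one_le_abs hi

/-- Bound on the contribution of one nonzero mode to the variance of the particle number. -/
theorem mode_bound {D η a c L N κ e t β : ℝ} (ha : 0 < a) (hc : 0 < c) (he : 0 < e)
    (hN : 1 ≤ N) (hL : 0 < L) (hη : 0 ≤ η) (hNκ : N / L ≤ κ) (hβ : β ≤ D - η)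
    (ht : t ^ 2 ≤ L ^ (-(D + η))) (hsmall : κ ≤ 1 → a * κ ^ η ≤ e) (hlarge : 1 ≤ κ → c ≤ e) :
    t ^ 2 * (Real.exp (-e) * (1 + 2 / e) ^ 2) ≤
      ((1 + 2 / c) ^ 2 + 2) * L ^ (-(D + η)) * Real.exp (-e) +
        8 / a ^ 2 * (L ^ (-β) * N ^ (-(D + η - β))) := by
  have hN0 : 0 < N := by linarith
  rcases le_total 1 κ with hκ | hκ
  · have h1 : (1 + 2 / e) ^ 2 ≤ (1 + 2 / c) ^ 2 + 2 := by
      have : (1 + 2 / e) ^ 2 ≤ (1 + 2 / c) ^ 2 := by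
        have := hlarge hκ
        gcongr
      linarith
    calc t ^ 2 * (Real.exp (-e) * (1 + 2 / e) ^ 2)
        ≤ L ^ (-(D + η)) * (Real.exp (-e) * ((1 + 2 / c) ^ 2 + 2)) := by gcongr
      _ = ((1 + 2 / c) ^ 2 + 2) * L ^ (-(D + η)) * Real.exp (-e) + 0 := by ring
      _ ≤ _ := by gcongr; positivity
  · have hy : 0 < N / L := by positivity
    have hlow : a * (N / L) ^ η ≤ e :=
      (mul_le_mul_of_nonneg_left (Real.rpow_le_rpow hy.le hNκ hη) ha.le).trans (hsmall hκ)
    have hNL : N ≤ L := (div_le_one hL).mp (hNκ.trans hκ)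
    have h1 : (1 + 2 / e) ^ 2 ≤ 2 + 8 * (1 / e ^ 2) := by
      have h := sq_nonneg (1 - 2 / e)
      have h' : 8 * (1 / e ^ 2) = 2 * (2 / e) ^ 2 := by ring
      rw [h']
      linarith
    have hexp : Real.exp (-e) ≤ 1 := Real.exp_le_one_iff.mpr (by linarith)
    have h2 : 1 / e ^ 2 ≤ 1 / a ^ 2 * (L ^ (2 * η) * N ^ (-(2 * η))) := by
      have h3 : 1 / a ^ 2 * (L ^ (2 * η) * N ^ (-(2 * η))) = 1 / (a * (N / L) ^ η) ^ 2 := by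
        rw [Real.div_rpow hN0.le hL.le, Real.rpow_neg hN0.le, mul_comm 2 η, Real.rpow_mul hL.le,
          Real.rpow_mul hN0.le, Real.rpow_two, Real.rpow_two]
        have := Real.rpow_pos_of_pos hN0 η
        have := Real.rpow_pos_of_pos hL η
        field_simp
      rw [h3]
      exact one_div_le_one_div_of_le (by positivity) (by gcongr)
    have h4 : L ^ (-(D + η)) * (L ^ (2 * η) * N ^ (-(2 * η))) ≤
        L ^ (-β) * N ^ (-(D + η - β)) := by
      have h5 : L ^ (-(D + η)) * L ^ (2 * η) = L ^ (-β) * L ^ (-(D - η - β)) := by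
        rw [← Real.rpow_add hL, ← Real.rpow_add hL]
        congr 1
        ring
      have h6 : N ^ (-(D + η - β)) = N ^ (-(D - η - β)) * N ^ (-(2 * η)) := by
        rw [← Real.rpow_add hN0]
        congr 1
        ring
      have h7 : L ^ (-(D - η - β)) ≤ N ^ (-(D - η - β)) :=
        Real.rpow_le_rpow_of_nonpos hN0 hNL (by linarith)
      rw [← mul_assoc, h5, h6, mul_assoc]
      gcongr
    calc t ^ 2 * (Real.exp (-e) * (1 + 2 / e) ^ 2)
        ≤ L ^ (-(D + η)) * (Real.exp (-e) * (2 + 8 * (1 / e ^ 2))) := by gcongr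
      _ = 2 * L ^ (-(D + η)) * Real.exp (-e) +
          Real.exp (-e) * (8 * (L ^ (-(D + η)) * (1 / e ^ 2))) := by ring
      _ ≤ 2 * L ^ (-(D + η)) * Real.exp (-e) +
          1 * (8 * (L ^ (-(D + η)) * (1 / a ^ 2 * (L ^ (2 * η) * N ^ (-(2 * η)))))) := by
        gcongr
      _ = 2 * L ^ (-(D + η)) * Real.exp (-e) +
          8 / a ^ 2 * (L ^ (-(D + η)) * (L ^ (2 * η) * N ^ (-(2 * η)))) := by ring
      _ ≤ ((1 + 2 / c) ^ 2 + 2) * L ^ (-(D + η)) * Real.exp (-e) +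
          8 / a ^ 2 * (L ^ (-β) * N ^ (-(D + η - β))) := by
        gcongr
        linarith [sq_nonneg (1 + 2 / c)]

theorem abs_div_volume_le {d : ℕ} (hd : 1 ≤ d) {η L l : ℝ} (hL : 0 < L)
    (hl : |l| ≤ (L ^ d) ^ ((1 - η / d) / 2)) : |l / L ^ d| ≤ L ^ (-((d + η) / 2)) := by
  have hd0 : (d : ℝ) ≠ 0 := by positivity
  rw [abs_div, abs_of_pos (pow_pos hL d), div_le_iff₀ (pow_pos hL d)]
  refine hl.trans (le_of_eq ?_)
  rw [← Real.rpow_natCast, ← Real.rpow_mul hL.le, ← Real.rpow_add hL]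
  congr 1
  field_simp
  ring

/-- Explicit bound on the logarithm of the exponential moment. -/
theorem abs_log_moment_le {d : ℕ} {ε : Eu d → ℝ} {α : ℕ → ℝ} {C a c η L t β : ℝ}
    (hε_pos : ∀ k : Eu d, k ≠ 0 → 0 < ε k) (ha : 0 < a) (hc : 0 < c) (hη : 0 ≤ η)
    (hε_low : ∀ k : Eu d, ‖k‖ ≤ 1 → a * ‖k‖ ^ η ≤ ε k) (hε_inf : ∀ k : Eu d, 1 ≤ ‖k‖ → c ≤ ε k)
    (hC : ∀ j : ℕ, 1 ≤ j → Real.exp (-α j) ≤ C) (hL : 0 < L)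
    (hsum : Summable fun z => boltzmann d ε L z) (hβ : β ≤ d - η) (hβη : β < η)
    (ht : t ^ 2 ≤ L ^ (-(d + η))) (ht1 : |t| ≤ 1)
    (htε : ∀ z : Fin d → ℤ, z ≠ 0 → |t| ≤ ε (dualPt d L z) / 2) :
    |∑' z, (cycleSeries α (boltzmann d ε L z * Real.exp t) -
        cycleSeries α (boltzmann d ε L z) - t * cycleSeriesDeriv α (boltzmann d ε L z))| ≤
      3 * C * (((1 + 2 / c) ^ 2 + 2) * L ^ (-(d + η)) * ∑' z, boltzmann d ε L z +
        8 / a ^ 2 * (L ^ (-β) * ∑' z : Fin d → ℤ, ‖z‖ ^ (-(d + η - β)))) := by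
  have hC0 : 0 ≤ C := (Real.exp_pos _).le.trans (hC 1 le_rfl)
  have hsN := summable_norm_int_rpow d (s := -(d + η - β)) (by linarith)
  have hS := ((hsum.hasSum.mul_left (((1 + 2 / c) ^ 2 + 2) * L ^ (-(d + η)))).add
    ((hsN.hasSum.mul_left (L ^ (-β))).mul_left (8 / a ^ 2))).mul_left (3 * C)
  rw [← Real.norm_eq_abs]
  refine tsum_of_norm_bounded hS fun z => ?_
  rw [Real.norm_eq_abs]
  by_cases hz : z = 0
  · rw [boltzmann, if_pos hz, zero_mul, cycleSeries_zero, cycleSeriesDeriv_zero]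
    simp only [sub_zero, mul_zero, abs_zero, zero_add]
    positivity
  · have hN := one_le_norm_int hz
    have hnorm := norm_int_div_le_norm_dualPt d hL z
    have hpos : 0 < ε (dualPt d L z) := hε_pos _ fun h => by
      rw [h, norm_zero] at hnorm
      exact absurd hnorm (not_le.mpr (by positivity))
    rw [boltzmann, if_neg hz]
    refine (abs_cycleSeries_sub_le hC hpos (htε z hz) ht1).trans ?_
    have h := mode_bound ha hc hpos hN hL hη hnorm hβ ht (hε_low _) (hε_inf _)
    calc _ = 3 * C * (t ^ 2 * (Real.exp (-ε (dualPt d L z)) *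
          (1 + 2 / ε (dualPt d L z)) ^ 2)) := by ring
      _ ≤ _ := by gcongr

/-- Proposition 4.3 (b): if `|λ(Λ)| ≤ |Λ|^{(1-η/d)/2}`, then
`∫ e^{λ(Λ)(s - ρ_c^{(Λ)})} dμ_Λ(s) → 1` as `L → ∞`. -/
theorem statement12
    (d : ℕ) (hd : 1 ≤ d) (ε : Eu d → ℝ)
    -- assumptions on the dispersion relation `ε`
    (hε0 : ε 0 = 0) (hε_nonneg : ∀ k, 0 ≤ ε k) (hε_pos : ∀ k : Eu d, k ≠ 0 → 0 < ε k)
    (hε_uc : UniformContinuous fun k => Real.exp (-ε k))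
    (a η : ℝ) (ha : 0 < a) (hη : 0 < η) (hηd : η < d)
    (hε_low : ∀ k : Eu d, ‖k‖ ≤ 1 → a * ‖k‖ ^ η ≤ ε k)
    (hε_inf : ∀ δ : ℝ, 0 < δ → ∃ c > (0:ℝ), ∀ k : Eu d, δ ≤ ‖k‖ → c ≤ ε k)
    -- convergence of the Riemann sums `|Λ|⁻¹ ∑_{k∈Λ*} e^{-ε(k)} → ∫ e^{-ε(k)} dk`
    (hRiemann : Tendsto
      (fun L : ℝ => (L ^ d)⁻¹ * ∑' z : Fin d → ℤ, Real.exp (-ε (dualPt d L z)))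
      atTop (𝓝 (∫ k : Eu d, Real.exp (-ε k))))
    -- bounded cycle weights: `sup_j e^{-α_j} < ∞`
    (α : ℕ → ℝ) (hα_bdd : ∃ C : ℝ, ∀ j : ℕ, 1 ≤ j → Real.exp (-α j) ≤ C)
    -- summability of `e^{-ε}` over the dual lattices (so each `μ_Λ` is well defined)
    (hlat : ∀ L : ℝ, 0 < L → Summable fun z : Fin d → ℤ => Real.exp (-ε (dualPt d L z)))
    -- the exponent `λ(Λ)`, bounded by `|Λ|^{(1-η/d)/2}`
    (lam : ℝ → ℝ) (hlam : ∀ L : ℝ, 0 < L → |lam L| ≤ (L ^ d) ^ ((1 - η / d) / 2)) :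
    Tendsto (fun L : ℝ =>
        (∑' N : ℕ, Zcheck d ε α L N *
            ENNReal.ofReal (Real.exp (lam L * ((N : ℝ) / L ^ d - rhoCL d ε α L)))) /
          (∑' N : ℕ, Zcheck d ε α L N))
      atTop (𝓝 1) := by
  obtain ⟨C, hC⟩ := hα_bdd
  obtain ⟨c, hc, hcε⟩ := hε_inf 1 one_pos
  have hdη : 0 < (d : ℝ) - η := by linarith
  have hd0 : (0 : ℝ) < d := by linarith
  set β : ℝ := min η (d - η) / 2 with hβ
  have hβ0 : 0 < β := by positivity
  have hβη : β < η := by linarith [min_le_left η (d - η)]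
  have hβd : β ≤ d - η := by linarith [min_le_right η (d - η)]
  have hsum : ∀ L : ℝ, 0 < L → Summable fun z => boltzmann d ε L z := fun L hL =>
    Summable.of_nonneg_of_le (boltzmann_nonneg d ε L) (boltzmann_le d ε L) (hlat L hL)
  let E : ℝ → ℝ := fun L => ∑' z, (cycleSeries α (boltzmann d ε L z * Real.exp (lam L / L ^ d)) -
    cycleSeries α (boltzmann d ε L z) -
      lam L / L ^ d * cycleSeriesDeriv α (boltzmann d ε L z))
  have hsmall : ∀ᶠ L : ℝ in atTop, 1 ≤ L ∧ |lam L / L ^ d| ≤ 1 ∧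
      ∀ z : Fin d → ℤ, z ≠ 0 → |lam L / L ^ d| ≤ ε (dualPt d L z) / 2 := by
    have h1 := (tendsto_rpow_neg_atTop (show 0 < (d + η) / 2 by linarith)).eventually_le_const
      (show (0 : ℝ) < min 1 (c / 2) by positivity)
    have h2 := (tendsto_rpow_neg_atTop (show 0 < (d - η) / 2 by linarith)).eventually_le_const
      (show (0 : ℝ) < a / 2 by positivity)
    filter_upwards [h1, h2, eventually_ge_atTop 1] with L h1 h2 hL
    have hL0 : 0 < L := by linarith
    have ht := abs_div_volume_le hd hL0 (hlam L hL0)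
    refine ⟨hL, (ht.trans h1).trans (min_le_left _ _), fun z hz => ?_⟩
    rcases le_total 1 ‖dualPt d L z‖ with hk | hk
    · linarith [hcε _ hk, (ht.trans h1).trans (min_le_right _ _)]
    · have h3 : a * L ^ (-η) ≤ ε (dualPt d L z) := by
        refine le_trans ?_ (hε_low _ hk)
        rw [Real.rpow_neg hL0.le, ← Real.inv_rpow hL0.le]
        gcongr
        refine le_trans ?_ (norm_int_div_le_norm_dualPt d hL0 z)
        rw [inv_eq_one_div]
        gcongr
        exact one_le_norm_int hz
      have h4 : L ^ (-((d + η) / 2)) ≤ a / 2 * L ^ (-η) := by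
        calc L ^ (-((d + η) / 2)) = L ^ (-((d - η) / 2)) * L ^ (-η) := by
              rw [← Real.rpow_add hL0]
              congr 1
              ring
          _ ≤ _ := by gcongr
      linarith
  have hE : Tendsto E atTop (𝓝 0) := by
    have hlim : Tendsto (fun L : ℝ => 3 * C * (((1 + 2 / c) ^ 2 + 2) * (L ^ (-η) *
        ((L ^ d)⁻¹ * ∑' z : Fin d → ℤ, Real.exp (-ε (dualPt d L z)))) +
          8 / a ^ 2 * (L ^ (-β) * ∑' z : Fin d → ℤ, ‖z‖ ^ (-(d + η - β))))) atTop (𝓝 0) := by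
      have h := ((((tendsto_rpow_neg_atTop hη).mul hRiemann).const_mul
        ((1 + 2 / c) ^ 2 + 2)).add (((tendsto_rpow_neg_atTop hβ0).mul_const
          (∑' z : Fin d → ℤ, ‖z‖ ^ (-(d + η - β)))).const_mul (8 / a ^ 2))).const_mul (3 * C)
      simpa using h
    refine squeeze_zero_norm' ?_ hlim
    filter_upwards [hsmall] with L ⟨hL, ht1, htε⟩
    have hL0 : 0 < L := by linarith
    have hC0 : 0 ≤ C := (Real.exp_pos _).le.trans (hC 1 le_rfl)
    have ht2 : (lam L / L ^ d) ^ 2 ≤ L ^ (-(d + η)) := by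
      rw [← sq_abs]
      calc |lam L / L ^ d| ^ 2 ≤ (L ^ (-((d + η) / 2))) ^ 2 := by
            gcongr
            exact abs_div_volume_le hd hL0 (hlam L hL0)
        _ = _ := by
            rw [← Real.rpow_mul_natCast hL0.le]
            congr 1
            push_cast
            ring
    refine (abs_log_moment_le hε_pos ha hc hη.le hε_low hcε hC hL0 (hsum L hL0) hβd hβη ht2 ht1
      htε).trans ?_
    have hsplit : L ^ (-(d + η)) = L ^ (-η) * (L ^ d)⁻¹ := by
      rw [← Real.rpow_natCast, ← Real.rpow_neg hL0.le, ← Real.rpow_add hL0]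
      congr 1
      ring
    rw [hsplit, mul_assoc ((1 + 2 / c) ^ 2 + 2), mul_assoc (L ^ (-η))]
    gcongr
    · exact hsum L hL0
    · exact hlat L hL0
    · exact boltzmann_le d ε L _
  have hlim : Tendsto (fun L => ENNReal.ofReal (Real.exp (E L))) atTop (𝓝 1) := by
    have h := ((ENNReal.continuous_ofReal.comp Real.continuous_exp).tendsto 0).comp hE
    simpa [Function.comp_def] using h
  refine hlim.congr' ?_
  filter_upwards [hsmall] with L ⟨hL, _, htε⟩
  have hL0 : 0 < L := by linarith
  obtain ⟨b, hb, hbε⟩ := hε_inf (1 / L) (by positivity)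
  have hgap : ∀ z : Fin d → ℤ, z ≠ 0 → b ≤ ε (dualPt d L z) := fun z hz => by
    refine hbε _ (le_trans ?_ (norm_int_div_le_norm_dualPt d hL0 z))
    gcongr
    exact one_le_norm_int hz
  refine (exponential_moment_eq d ε α hC hL0 rfl (hsum L hL0) (Real.exp_pos (-(b / 2))).le
    (Real.exp_lt_one_iff.mpr (by linarith)) (fun z => ?_) fun z => ?_).symm
  · rw [boltzmann]
    split_ifs with hz
    · positivity
    · exact Real.exp_le_exp.mpr (by linarith [hgap z hz])
  · rw [boltzmann]
    split_ifs with hz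
    · rw [zero_mul]
      positivity
    · rw [← Real.exp_add]
      exact Real.exp_le_exp.mpr (by
        linarith [hgap z hz, htε z hz, le_abs_self (lam L / L ^ d)])
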